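/- Let n be a positive integer and let G be a connected graph cospectral with the friendship graph F_n. If G contains no cycle of length 5 as a (not necessarily induced) subgraph, then G is isomorphic to F_n. -/

import Mathlib

open Polynomial

/-- The adjacency matrix of a simple graph, with entries in `R`. -/
noncomputable def adjMat (R : Type*) [Zero R] [One R] {V : Type*} [Fintype V]
    (G : SimpleGraph V) : Matrix V V R :=
  letI := Classical.decRel G.Adj
  G.adjMatrix R

/-- The friendship graph `F n`: `n` triangles glued at the common vertex `none`. -/
def friendshipGraph (n : ℕ) : SimpleGraph (Option (Fin n × Bool)) :=
  SimpleGraph.fromRel (fun u v =>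
    u = none ∨ ∃ i : Fin n, u = some (i, true) ∧ v = some (i, false))

/-- Two finite graphs are cospectral if their real adjacency matrices have the same
characteristic polynomial. -/
def Cospectral {V W : Type*} [Fintype V] [Fintype W] [DecidableEq V] [DecidableEq W]
    (G : SimpleGraph V) (H : SimpleGraph W) : Prop :=
  (adjMat ℝ G).charpoly = (adjMat ℝ H).charpoly


open Matrix

lemma Matrix.IsSymm.exists_orthogonal_conj {V W : Type*} [Fintype V] [Fintype W] [DecidableEq V]
    [DecidableEq W] {A : Matrix V V ℝ} {B : Matrix W W ℝ} (hA : A.IsSymm) (hB : B.IsSymm)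
    (h : A.charpoly = B.charpoly) :
    ∃ Q : Matrix V W ℝ, Q * Qᵀ = 1 ∧ Qᵀ * Q = 1 ∧ A = Q * B * Qᵀ := by
  have hcard : Fintype.card V = Fintype.card W := by
    rw [← charpoly_natDegree_eq_dim A, ← charpoly_natDegree_eq_dim B, h]
  let e : W ≃ V := Fintype.equivOfCardEq hcard.symm
  have hA' : A.IsHermitian := by
    rw [IsHermitian, conjTranspose_eq_transpose_of_trivial]; exact hA
  have hB' : (B.reindex e e).IsHermitian := by
    rw [IsHermitian, conjTranspose_eq_transpose_of_trivial, transpose_reindex, hB.eq]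
  have hev : hA'.eigenvalues = hB'.eigenvalues :=
    (hA'.eigenvalues_eq_eigenvalues_iff hB').2 (by rw [h, charpoly_reindex])
  have h1 := hA'.spectral_theorem
  have h2 := hB'.spectral_theorem
  rw [Unitary.conjStarAlgAut_apply] at h1 h2
  set U := hA'.eigenvectorUnitary
  set P := hB'.eigenvectorUnitary
  rw [← hev] at h2
  set D : Matrix V V ℝ := diagonal (RCLike.ofReal ∘ hA'.eigenvalues)
  have hU1 : (U : Matrix V V ℝ) * star (U : Matrix V V ℝ) = 1 := Unitary.mul_star_self_of_mem U.2
  have hU2 : star (U : Matrix V V ℝ) * (U : Matrix V V ℝ) = 1 := Unitary.star_mul_self_of_mem U.2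
  have hP1 : (P : Matrix V V ℝ) * star (P : Matrix V V ℝ) = 1 := Unitary.mul_star_self_of_mem P.2
  have hP2 : star (P : Matrix V V ℝ) * (P : Matrix V V ℝ) = 1 := Unitary.star_mul_self_of_mem P.2
  have hD : D = star (P : Matrix V V ℝ) * B.reindex e e * P := by
    rw [h2]
    simp only [mul_assoc, hP2, mul_one]
    rw [← mul_assoc, hP2, one_mul]
  set R : Matrix V V ℝ := U * star (P : Matrix V V ℝ) with hR
  have hRt : Rᵀ = P * star (U : Matrix V V ℝ) := by
    rw [← conjTranspose_eq_transpose_of_trivial, ← star_eq_conjTranspose, hR, star_mul, star_star]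
  have hR1 : R * Rᵀ = 1 := by
    rw [hRt, hR, mul_assoc, ← mul_assoc _ (P : Matrix V V ℝ), hP2, one_mul, hU1]
  have hR2 : Rᵀ * R = 1 := by
    rw [hRt, hR, mul_assoc, ← mul_assoc _ (U : Matrix V V ℝ), hU2, one_mul, hP1]
  refine ⟨R.submatrix id e, ?_, ?_, ?_⟩
  · rw [transpose_submatrix, submatrix_mul_equiv, hR1, submatrix_id_id]
  · rw [transpose_submatrix, ← submatrix_mul _ _ _ _ _ Function.bijective_id, hR2,
      submatrix_one_equiv]
  · have hBe : B = (B.reindex e e).submatrix e e := by simp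
    rw [hBe, transpose_submatrix, submatrix_mul_equiv, submatrix_mul_equiv, submatrix_id_id, hRt,
      hR]
    conv_lhs => rw [h1, hD]
    simp only [mul_assoc]

lemma adjMat_apply {V : Type*} [Fintype V] (G : SimpleGraph V) [DecidableRel G.Adj] (u v : V) :
    adjMat ℝ G u v = if G.Adj u v then 1 else 0 := by
  simp only [adjMat, SimpleGraph.adjMatrix_apply]
  congr

lemma adjMat_isSymm {V : Type*} [Fintype V] (G : SimpleGraph V) : (adjMat ℝ G).IsSymm := by
  classical
  exact SimpleGraph.isSymm_adjMatrix _

lemma friendshipGraph_adj_none_some {n : ℕ} (x : Fin n × Bool) :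
    (friendshipGraph n).Adj none (some x) := by
  simp [friendshipGraph]

lemma friendshipGraph_adj_some_some {n : ℕ} (i j : Fin n) (a b : Bool) :
    (friendshipGraph n).Adj (some (i, a)) (some (j, b)) ↔ i = j ∧ a = !b := by
  cases a <;> cases b <;> simp [friendshipGraph, eq_comm]

lemma adjMat_friendshipGraph_none_none (n : ℕ) :
    adjMat ℝ (friendshipGraph n) none none = 0 := by
  classical
  rw [adjMat_apply, if_neg (SimpleGraph.irrefl _)]

lemma adjMat_friendshipGraph_none_some {n : ℕ} (x : Fin n × Bool) :
    adjMat ℝ (friendshipGraph n) none (some x) = 1 := by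
  classical
  rw [adjMat_apply, if_pos (friendshipGraph_adj_none_some x)]

lemma adjMat_friendshipGraph_some_none {n : ℕ} (x : Fin n × Bool) :
    adjMat ℝ (friendshipGraph n) (some x) none = 1 := by
  classical
  rw [adjMat_apply, if_pos (friendshipGraph_adj_none_some x).symm]

lemma adjMat_friendshipGraph_some_some {n : ℕ} (i j : Fin n) (a b : Bool) :
    adjMat ℝ (friendshipGraph n) (some (i, a)) (some (j, b)) =
      if i = j then (if a = !b then 1 else 0) else 0 := by
  classical
  rw [adjMat_apply, ← ite_and]
  exact if_congr (friendshipGraph_adj_some_some i j a b) rfl rfl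

/-- The square of the adjacency matrix of `F n` is the identity plus a rank two matrix. -/
lemma friendshipGraph_sq (n : ℕ) :
    adjMat ℝ (friendshipGraph n) * adjMat ℝ (friendshipGraph n) =
      1 + (vecMulVec 1 1 + (2 * n - 2 : ℝ) • vecMulVec (Pi.single none 1) (Pi.single none 1)) := by
  ext u v
  rcases u with _ | ⟨i, a⟩ <;> rcases v with _ | ⟨j, b⟩
  all_goals
    simp only [mul_apply, Fintype.sum_option, Fintype.sum_prod_type, Fintype.sum_bool,
      adjMat_friendshipGraph_none_none, adjMat_friendshipGraph_none_some,
      adjMat_friendshipGraph_some_none, adjMat_friendshipGraph_some_some, Matrix.add_apply,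
      Matrix.smul_apply, vecMulVec_apply, Matrix.one_apply]
  · simp; ring
  · cases b <;> simp
  · cases a <;> simp
  · cases a <;> cases b <;> by_cases h : i = j <;> simp [h]

lemma friendshipGraph_quartic (n : ℕ) :
    let B := adjMat ℝ (friendshipGraph n)
    (B * B - 1) * (B * B - 1) = (2 * n - 1 : ℝ) • (B * B - 1) + (B * B - 1) * B := by
  intro B
  have hM : B * B - 1 =
      vecMulVec 1 1 + (2 * n - 2 : ℝ) • vecMulVec (Pi.single none 1) (Pi.single none 1) := by
    rw [friendshipGraph_sq, add_sub_cancel_left]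
  rw [hM]
  ext u v
  rcases u with _ | ⟨i, a⟩ <;> rcases v with _ | ⟨j, b⟩
  all_goals
    simp only [B, mul_apply, Fintype.sum_option, Fintype.sum_prod_type, Fintype.sum_bool,
      adjMat_friendshipGraph_none_none, adjMat_friendshipGraph_none_some,
      adjMat_friendshipGraph_some_none, adjMat_friendshipGraph_some_some, Matrix.add_apply,
      Matrix.smul_apply, vecMulVec_apply]
  · simp; ring_nf; simp
  · cases b <;> simp <;> ring
  · simp; ring
  · cases b <;> simp <;> ring

lemma friendshipGraph_trace (n : ℕ) :
    (adjMat ℝ (friendshipGraph n) * adjMat ℝ (friendshipGraph n) - 1).trace = 4 * n - 1 := by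
  rw [friendshipGraph_sq, add_sub_cancel_left]
  simp [trace, vecMulVec_apply]
  ring

/-- The consequences of being cospectral with `F n` that the classification rests on. -/
lemma Cospectral.exists_rank_two {V : Type*} [Fintype V] [DecidableEq V] {n : ℕ} {G : SimpleGraph V}
    (hG : Cospectral G (friendshipGraph n)) :
    ∃ M : Matrix V V ℝ, M = adjMat ℝ G * adjMat ℝ G - 1 ∧
      (∃ a b : V → ℝ, ∀ u v, M u v = a u * a v + (2 * n - 2) * (b u * b v)) ∧
      M * M = (2 * n - 1 : ℝ) • M + M * adjMat ℝ G ∧ M.trace = 4 * n - 1 ∧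
      Fintype.card V = 2 * n + 1 := by
  obtain ⟨Q, h1, h2, hA⟩ :=
    (adjMat_isSymm G).exists_orthogonal_conj (adjMat_isSymm (friendshipGraph n)) hG
  set B := adjMat ℝ (friendshipGraph n) with hB
  have hmul (X Y : Matrix (Option (Fin n × Bool)) (Option (Fin n × Bool)) ℝ) :
      (Q * X * Qᵀ) * (Q * Y * Qᵀ) = Q * (X * Y) * Qᵀ := by
    calc _ = Q * X * (Qᵀ * Q) * Y * Qᵀ := by simp only [Matrix.mul_assoc]
      _ = _ := by rw [h2, Matrix.mul_one]; simp only [Matrix.mul_assoc]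
  have hM : adjMat ℝ G * adjMat ℝ G - 1 = Q * (B * B - 1) * Qᵀ := by
    rw [hA, hmul, Matrix.mul_sub, Matrix.sub_mul, Matrix.mul_one, h1]
  refine ⟨_, rfl, ?_, ?_, ?_, ?_⟩
  · refine ⟨Q *ᵥ 1, Q *ᵥ Pi.single none 1, fun u v => ?_⟩
    rw [hM, hB, friendshipGraph_sq, add_sub_cancel_left, Matrix.mul_add, Matrix.add_mul,
      Matrix.mul_smul, Matrix.smul_mul, mul_vecMulVec, mul_vecMulVec, vecMulVec_mul,
      vecMulVec_mul, vecMul_transpose, vecMul_transpose]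
    simp only [Matrix.add_apply, Matrix.smul_apply, vecMulVec_apply, smul_eq_mul]
  · rw [hM, hA, hmul, hmul, friendshipGraph_quartic, Matrix.mul_add, Matrix.add_mul,
      Matrix.mul_smul, Matrix.smul_mul]
  · rw [hM, trace_mul_comm, ← Matrix.mul_assoc, h2, Matrix.one_mul, friendshipGraph_trace]
  · rw [← charpoly_natDegree_eq_dim (adjMat ℝ G), hG, charpoly_natDegree_eq_dim]
    simp [mul_comm]

open Finset in
/-- `M` is the matrix `A ^ 2 - 1` of a connected graph `G`, and it satisfies the identities that
cospectrality with `F n` forces. -/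
structure IsFriendshipSquare {V : Type*} [Fintype V] [DecidableEq V] (G : SimpleGraph V)
    [DecidableRel G.Adj] (n : ℕ) (M : Matrix V V ℝ) : Prop where
  pos : 0 < n
  connected : G.Connected
  card : Fintype.card V = 2 * n + 1
  off_diag : ∀ u v, u ≠ v → M u v = (#(G.neighborFinset u ∩ G.neighborFinset v) : ℝ)
  diag : ∀ u, M u u = G.degree u - 1
  gram : ∃ a b : V → ℝ, ∀ u v, M u v = a u * a v + (2 * n - 2) * (b u * b v)
  row_sq : ∀ u, ∑ w, M u w ^ 2 = (2 * n - 1) * M u u + ∑ w ∈ G.neighborFinset u, M u w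
  trace : ∑ u, M u u = 4 * n - 1

lemma SimpleGraph.Connected.mem_of_closed {V : Type*} {G : SimpleGraph V} (hG : G.Connected)
    {s : Set V} {x : V} (hx : x ∈ s) (hs : ∀ u ∈ s, ∀ v, G.Adj u v → v ∈ s) (y : V) : y ∈ s := by
  obtain ⟨p⟩ := hG.preconnected x y
  induction p with
  | nil => exact hx
  | cons h _ ih => exact ih (hs _ hx _ h)

lemma SimpleGraph.exists_neighborFinset_eq_pair {V : Type*} [Fintype V] [DecidableEq V]
    {G : SimpleGraph V} [DecidableRel G.Adj] {u a : V} (hu : G.degree u = 2) (ha : G.Adj u a) :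
    ∃ b, a ≠ b ∧ G.neighborFinset u = {a, b} := by
  obtain ⟨x, y, hxy, h⟩ := Finset.card_eq_two.1 ((G.card_neighborFinset_eq_degree u).trans hu)
  have : a ∈ G.neighborFinset u := by simpa using ha
  rw [h, Finset.mem_insert, Finset.mem_singleton] at this
  rcases this with rfl | rfl
  · exact ⟨y, hxy, h⟩
  · exact ⟨x, hxy.symm, by rw [h, Finset.pair_comm]⟩

namespace IsFriendshipSquare

open Finset

variable {V : Type*} [Fintype V] [DecidableEq V] {G : SimpleGraph V} [DecidableRel G.Adj] {n : ℕ}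
  {M : Matrix V V ℝ}

lemma symm (h : IsFriendshipSquare G n M) (u v : V) : M u v = M v u := by
  obtain ⟨a, b, hab⟩ := h.gram
  rw [hab, hab]; ring

lemma sq_le (h : IsFriendshipSquare G n M) (u v : V) : M u v ^ 2 ≤ M u u * M v v := by
  obtain ⟨a, b, hab⟩ := h.gram
  have hn : (1 : ℝ) ≤ n := by exact_mod_cast h.pos
  have : 0 ≤ (2 * n - 2) * (a u * b v - a v * b u) ^ 2 :=
    mul_nonneg (by linarith) (sq_nonneg _)
  simp only [hab]
  linarith

lemma det_eq_zero (h : IsFriendshipSquare G n M) (u v w : V) :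
    M u u * M v v * M w w + 2 * M u v * M v w * M u w - M u u * M v w ^ 2 - M v v * M u w ^ 2
      - M w w * M u v ^ 2 = 0 := by
  obtain ⟨a, b, hab⟩ := h.gram
  simp only [hab]
  ring

lemma diag_of_degree (h : IsFriendshipSquare G n M) {u : V} (hu : G.degree u = 2) :
    M u u = 1 := by
  rw [h.diag, hu]; norm_num

lemma one_le (h : IsFriendshipSquare G n M) {u v w : V} (huv : u ≠ v) (hu : G.Adj u w)
    (hv : G.Adj v w) : 1 ≤ M u v := by
  rw [h.off_diag u v huv]
  exact_mod_cast Finset.card_pos.2 ⟨w, by simp [hu, hv]⟩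

lemma two_le (h : IsFriendshipSquare G n M) {u v w x : V} (huv : u ≠ v) (hwx : w ≠ x)
    (huw : G.Adj u w) (hvw : G.Adj v w) (hux : G.Adj u x) (hvx : G.Adj v x) : 2 ≤ M u v := by
  rw [h.off_diag u v huv]
  exact_mod_cast Finset.one_lt_card.2 ⟨w, by simp [huw, hvw], x, by simp [hux, hvx], hwx⟩

lemma exists_common_of_ne_zero (h : IsFriendshipSquare G n M) {u v : V} (huv : u ≠ v)
    (h0 : M u v ≠ 0) : ∃ w, G.Adj u w ∧ G.Adj v w := by
  rw [h.off_diag u v huv, Nat.cast_ne_zero, Finset.card_ne_zero] at h0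
  obtain ⟨w, hw⟩ := h0
  exact ⟨w, by simpa using hw⟩

/-- Every entry in the row of a vertex with exactly two neighbours. -/
lemma eq_of_neighborFinset (h : IsFriendshipSquare G n M) {u a b w : V} (hab : a ≠ b)
    (hu : G.neighborFinset u = {a, b}) (hw : u ≠ w) :
    M u w = (if G.Adj a w then 1 else 0) + (if G.Adj b w then 1 else 0) := by
  rw [h.off_diag u w hw, hu]
  by_cases ha : G.Adj a w <;> by_cases hb : G.Adj b w <;>
    simp [Finset.insert_inter_of_mem, Finset.insert_inter_of_notMem, Finset.singleton_inter_of_mem,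
      Finset.singleton_inter_of_notMem, G.adj_comm w, ha, hb, hab]
  norm_num

lemma two_le_degree (h : IsFriendshipSquare G n M) (u : V) : 2 ≤ G.degree u := by
  have hcard := h.card
  have hpos := h.pos
  have : Nontrivial V := Fintype.one_lt_card_iff_nontrivial.1 (by omega)
  have h1 : 0 < G.degree u := h.connected.preconnected.degree_pos_of_nontrivial u
  by_contra! hlt
  have hd : G.degree u = 1 := by omega
  obtain ⟨a, ha⟩ := Finset.card_eq_one.1 ((G.card_neighborFinset_eq_degree u).trans hd)
  have hadj (v : V) : G.Adj u v ↔ v = a := by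
    rw [← G.mem_neighborFinset, ha, Finset.mem_singleton]
  have hrow (v : V) : M u v = 0 := by
    have := h.sq_le u v
    rw [h.diag u, hd] at this
    norm_num at this
    exact this
  have hall (y : V) : y ∈ ({u, a} : Set V) := by
    refine h.connected.mem_of_closed (x := u) (by simp) ?_ y
    rintro v (rfl | rfl) w hw
    · right; exact (hadj w).1 hw
    · by_contra hne
      have := h.one_le (u := u) (v := w) (w := v) (fun e => hne (by simp [e]))
        ((hadj v).2 rfl) hw.symm
      rw [hrow w] at this
      norm_num at this
  have : Fintype.card V ≤ 2 := by
    rw [← Finset.card_univ]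
    refine (Finset.card_le_card (t := {u, a}) fun y _ => ?_).trans Finset.card_le_two
    simpa using hall y
  omega

lemma sum_row_eq (h : IsFriendshipSquare G n M) {u : V} (hu : G.degree u = 2) :
    ∃ t : ℕ, ∑ w, M u w ^ 2 = (2 * n - 1) + 2 * t := by
  obtain ⟨a, ha⟩ := Finset.card_pos.1
    (by rw [G.card_neighborFinset_eq_degree, hu]; norm_num : 0 < #(G.neighborFinset u))
  obtain ⟨b, hab, hN⟩ := G.exists_neighborFinset_eq_pair hu (by simpa using ha)
  have hua : G.Adj u a := by simpa using ha
  have hub : G.Adj u b := by rw [← G.mem_neighborFinset, hN]; simp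
  rw [h.row_sq, hN, Finset.sum_pair hab, h.diag_of_degree hu,
    h.eq_of_neighborFinset hab hN hua.ne, h.eq_of_neighborFinset hab hN hub.ne]
  refine ⟨if G.Adj a b then 1 else 0, ?_⟩
  simp only [SimpleGraph.irrefl, if_false, G.adj_comm b a]
  split_ifs <;> norm_num

lemma eq_one_of_degree (h : IsFriendshipSquare G n M) {u v : V} (huv : u ≠ v)
    (hu : G.degree u = 2) (hv : G.degree v = 2) : M u v = 1 := by
  have h0 : M u v ≠ 0 := by
    intro h0
    have hw (w : V) : M w w = M u w ^ 2 + M v w ^ 2 := by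
      have := h.det_eq_zero u v w
      rw [h.diag_of_degree hu, h.diag_of_degree hv, h0] at this
      linarith
    have htr := h.trace
    simp only [hw, Finset.sum_add_distrib] at htr
    obtain ⟨s, hs⟩ := h.sum_row_eq hu
    obtain ⟨t, ht⟩ := h.sum_row_eq hv
    rw [hs, ht] at htr
    have : (2 * (s + t) : ℝ) = 1 := by linarith
    have : 2 * (s + t) = 1 := by exact_mod_cast this
    omega
  have hle := h.sq_le u v
  rw [h.diag_of_degree hu, h.diag_of_degree hv, h.off_diag u v huv] at hle
  rw [h.off_diag u v huv] at h0 ⊢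
  have h1 : #(G.neighborFinset u ∩ G.neighborFinset v) ^ 2 ≤ 1 := by
    rw [one_mul] at hle; exact_mod_cast hle
  have h2 : #(G.neighborFinset u ∩ G.neighborFinset v) ≠ 0 := by exact_mod_cast h0
  have h3 : #(G.neighborFinset u ∩ G.neighborFinset v) = 1 := by
    have := (Nat.pow_le_one_iff two_ne_zero).1 h1
    omega
  rw [h3, Nat.cast_one]

lemma row_eq_row (h : IsFriendshipSquare G n M) {u v : V}
    (hu : G.degree u = 2) (hv : G.degree v = 2) (w : V) : M u w = M v w := by
  by_cases huv : u = v
  · rw [huv]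
  have := h.det_eq_zero u v w
  rw [h.diag_of_degree hu, h.diag_of_degree hv, h.eq_one_of_degree huv hu hv] at this
  have : (M u w - M v w) ^ 2 = 0 := by linarith
  exact sub_eq_zero.1 (pow_eq_zero_iff two_ne_zero |>.1 this)

lemma eq_of_common (h : IsFriendshipSquare G n M) {u v w x : V} (huv : u ≠ v)
    (hu : G.degree u = 2) (hv : G.degree v = 2) (huw : G.Adj u w) (hvw : G.Adj v w)
    (hux : G.Adj u x) (hvx : G.Adj v x) : w = x := by
  by_contra hwx
  have := h.two_le huv hwx huw hvw hux hvx
  rw [h.eq_one_of_degree huv hu hv] at this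
  norm_num at this

lemma exists_common (h : IsFriendshipSquare G n M) {u v : V} (huv : u ≠ v)
    (hu : G.degree u = 2) (hv : G.degree v = 2) : ∃ w, G.Adj u w ∧ G.Adj v w :=
  h.exists_common_of_ne_zero huv (by rw [h.eq_one_of_degree huv hu hv]; norm_num)

lemma sum_degree (h : IsFriendshipSquare G n M) : ∑ v, G.degree v = 6 * n := by
  have := h.trace
  simp only [h.diag, Finset.sum_sub_distrib, Finset.sum_const, Finset.card_univ, h.card] at this
  have h2 : (∑ v, (G.degree v : ℝ)) = 6 * n := by
    push_cast [nsmul_eq_mul] at this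
    linarith
  exact_mod_cast h2

/-- Lower bound for the degree sum: vertices of degree two contribute two each, those in `s`
contribute their degrees, and all others at least three each. -/
lemma sum_degree_ge (h : IsFriendshipSquare G n M) {s : Finset V}
    (hs : ∀ v ∈ s, G.degree v ≠ 2) :
    ∑ v ∈ s, G.degree v + 6 * n + 3 ≤ 6 * n + #{v | G.degree v = 2} + 3 * #s := by
  set D : Finset V := {v | G.degree v = 2} with hD
  have hdisj : Disjoint D s := by
    rw [Finset.disjoint_left]
    intro v hv hvs
    exact hs v hvs (by simpa [hD] using hv)
  have hsum := h.sum_degree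
  rw [← Finset.sum_add_sum_compl (D ∪ s), Finset.sum_union hdisj] at hsum
  have h1 : ∑ v ∈ D, G.degree v = 2 * #D := by
    rw [Finset.sum_congr rfl (g := fun _ => 2) (fun v hv => by simpa [hD] using hv)]
    simp [mul_comm]
  have h2 : 3 * #(D ∪ s)ᶜ ≤ ∑ v ∈ (D ∪ s)ᶜ, G.degree v := by
    rw [mul_comm, ← smul_eq_mul]
    refine Finset.card_nsmul_le_sum _ _ _ fun v hv => ?_
    have h3 : G.degree v ≠ 2 := by
      simp only [Finset.mem_compl, Finset.mem_union, not_or] at hv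
      simpa [hD] using hv.1
    have := h.two_le_degree v
    omega
  have h3 := Finset.card_add_card_compl (D ∪ s)
  rw [Finset.card_union_of_disjoint hdisj, h.card] at h3
  omega

lemma three_le_card (h : IsFriendshipSquare G n M) : 3 ≤ #{v | G.degree v = 2} := by
  have := h.sum_degree_ge (s := ∅) (by simp)
  simp only [Finset.sum_empty, Finset.card_empty] at this
  omega

lemma degree_le (h : IsFriendshipSquare G n M) {w : V} (hw : G.degree w ≠ 2) :
    G.degree w ≤ #{v | G.degree v = 2} := by
  have := h.sum_degree_ge (s := {w}) (by simpa using hw)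
  simp only [Finset.sum_singleton, Finset.card_singleton] at this
  omega

lemma degree_add_le (h : IsFriendshipSquare G n M) {w c : V} (hwc : w ≠ c)
    (hw : G.degree w ≠ 2) (hc : G.degree c ≠ 2) :
    G.degree w + G.degree c ≤ #{v | G.degree v = 2} + 3 := by
  have := h.sum_degree_ge (s := {w, c}) (by simp [hw, hc])
  rw [Finset.sum_pair hwc, Finset.card_pair hwc] at this
  omega

end IsFriendshipSquare

namespace IsFriendshipSquare

open Finset

variable {V : Type*} [Fintype V] [DecidableEq V] {G : SimpleGraph V} [DecidableRel G.Adj] {n : ℕ}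
  {M : Matrix V V ℝ}

/-- If some vertex is adjacent to all vertices of degree two, then `G` consists of triangles
sharing that vertex. -/
lemma adj_and_degree_of_forall_adj (h : IsFriendshipSquare G n M) {c : V}
    (hc : ∀ u, G.degree u = 2 → G.Adj c u) (v : V) (hv : v ≠ c) :
    G.Adj c v ∧ G.degree v = 2 := by
  have hk := h.three_le_card
  have hsub : ({v | G.degree v = 2} : Finset V) ⊆ G.neighborFinset c := by
    intro u hu
    simpa using hc u (by simpa using hu)
  have hck := Finset.card_le_card hsub
  rw [G.card_neighborFinset_eq_degree] at hck
  have hc2 : G.degree c ≠ 2 := by omega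
  have hN := Finset.eq_of_subset_of_card_le hsub
    (by rw [G.card_neighborFinset_eq_degree]; exact h.degree_le hc2)
  have hadj (w : V) : G.Adj c w ↔ G.degree w = 2 := by
    rw [← G.mem_neighborFinset, ← hN]; simp
  have hnext (u b : V) (hu : G.degree u = 2) (hub : G.Adj u b) (hbc : b ≠ c) :
      G.degree b = 2 := by
    by_contra hb
    have huc : G.Adj u c := (hc u hu).symm
    have hbc' : ¬ G.Adj c b := fun e => hb ((hadj b).1 e)
    obtain ⟨b', hb'c, hNu⟩ := G.exists_neighborFinset_eq_pair hu huc
    have hbb' : b = b' := by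
      have : b ∈ G.neighborFinset u := by simpa using hub
      rw [hNu] at this
      simpa [hbc] using this
    subst hbb'
    have h1 : M u b = 0 := by
      rw [h.eq_of_neighborFinset hb'c hNu hub.ne]; simp [hbc']
    have h2 : M u c = 0 := by
      rw [h.eq_of_neighborFinset hb'c hNu huc.ne]; simp [G.adj_comm b c, hbc']
    have h3 : M b c = 1 := by
      have : G.neighborFinset b ∩ G.neighborFinset c = {u} := by
        ext x
        simp only [Finset.mem_inter, SimpleGraph.mem_neighborFinset, Finset.mem_singleton]
        constructor
        · rintro ⟨hbx, hcx⟩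
          by_contra hxu
          exact hbc (h.eq_of_common hxu ((hadj x).1 hcx) hu hbx.symm hub hcx.symm huc)
        · rintro rfl
          exact ⟨hub.symm, huc.symm⟩
      rw [h.off_diag b c hbc, this, Finset.card_singleton, Nat.cast_one]
    have h4 := h.det_eq_zero u b c
    have hb3 := h.degree_add_le hbc hb hc2
    have hb3' := h.two_le_degree b
    have hb3 : G.degree b = 3 := by omega
    rw [h1, h2, h3, h.diag_of_degree hu, h.diag b, h.diag c, hb3] at h4
    have : (3 : ℝ) ≤ G.degree c := by exact_mod_cast hk.trans hck
    push_cast at h4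
    linarith
  have hall (y : V) : y ∈ {v | v = c ∨ G.degree v = 2} := by
    refine h.connected.mem_of_closed (x := c) (by simp) ?_ y
    rintro u (rfl | hu) w huw
    · exact Or.inr ((hadj w).1 huw)
    · by_cases hw : w = c
      · exact Or.inl hw
      · exact Or.inr (hnext u w hu huw hw)
  have h2 : G.degree v = 2 := (hall v).resolve_left hv
  exact ⟨(hadj v).2 h2, h2⟩

lemma exists_center (h : IsFriendshipSquare G n M) :
    ∃ c, ∀ v, v ≠ c → G.Adj c v ∧ G.degree v = 2 := by
  obtain ⟨u₁, hu₁, u₂, hu₂, h12⟩ := Finset.one_lt_card.1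
    (show 1 < #{v | G.degree v = 2} by have := h.three_le_card; omega)
  replace hu₁ : G.degree u₁ = 2 := by simpa using hu₁
  replace hu₂ : G.degree u₂ = 2 := by simpa using hu₂
  obtain ⟨y, h1y, h2y⟩ := h.exists_common h12 hu₁ hu₂
  by_cases hstar : ∀ u, G.degree u = 2 → G.Adj y u
  · exact ⟨y, h.adj_and_degree_of_forall_adj hstar⟩
  push Not at hstar
  obtain ⟨u₃, hu₃, h3y⟩ := hstar
  obtain ⟨x, hyx, hN1⟩ := G.exists_neighborFinset_eq_pair hu₁ h1y
  obtain ⟨z, hyz, hN2⟩ := G.exists_neighborFinset_eq_pair hu₂ h2y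
  have h13 : u₁ ≠ u₃ := by rintro rfl; exact h3y h1y.symm
  have h23 : u₂ ≠ u₃ := by rintro rfl; exact h3y h2y.symm
  have hadj1 (w : V) : G.Adj u₁ w ↔ w = y ∨ w = x := by
    rw [← G.mem_neighborFinset, hN1]; simp
  have hadj2 (w : V) : G.Adj u₂ w ↔ w = y ∨ w = z := by
    rw [← G.mem_neighborFinset, hN2]; simp
  have h1x := (hadj1 x).2 (Or.inr rfl)
  have h2z := (hadj2 z).2 (Or.inr rfl)
  have h3x : G.Adj u₃ x := by
    obtain ⟨w, hw1, hw3⟩ := h.exists_common h13 hu₁ hu₃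
    rcases (hadj1 w).1 hw1 with rfl | rfl
    · exact absurd hw3.symm h3y
    · exact hw3
  have h3z : G.Adj u₃ z := by
    obtain ⟨w, hw2, hw3⟩ := h.exists_common h23 hu₂ hu₃
    rcases (hadj2 w).1 hw2 with rfl | rfl
    · exact absurd hw3.symm h3y
    · exact hw3
  have hxz : x ≠ z := by
    rintro rfl
    exact hyx (h.eq_of_common h12 hu₁ hu₂ h1y h2y h1x h2z)
  obtain ⟨z', hxz', hN3⟩ := G.exists_neighborFinset_eq_pair hu₃ h3x
  obtain rfl : z = z' := by
    have : z ∈ G.neighborFinset u₃ := by simpa using h3z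
    rw [hN3] at this
    simpa [hxz.symm] using this
  have hadj3 (w : V) : G.Adj u₃ w ↔ w = x ∨ w = z := by
    rw [← G.mem_neighborFinset, hN3]; simp
  have hD (u : V) (hu : G.degree u = 2) : u = u₁ ∨ u = u₂ ∨ u = u₃ := by
    by_contra! hne
    obtain ⟨n1, n2, n3⟩ := hne
    obtain ⟨a, ha, ha1⟩ := h.exists_common n1 hu hu₁
    obtain ⟨b, hb, hb2⟩ := h.exists_common n2 hu hu₂
    obtain ⟨d, hd, hd3⟩ := h.exists_common n3 hu hu₃
    by_cases huy : G.Adj u y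
    · rcases (hadj3 d).1 hd3 with rfl | rfl
      · exact hyx (h.eq_of_common n1 hu hu₁ huy h1y hd h1x)
      · exact hyz (h.eq_of_common n2 hu hu₂ huy h2y hd h2z)
    · rcases (hadj1 a).1 ha1 with rfl | rfl
      · exact huy ha
      rcases (hadj2 b).1 hb2 with rfl | rfl
      · exact huy hb
      exact hxz (h.eq_of_common n3 hu hu₃ ha h3x hb h3z)
  by_cases hx2 : x = u₂
  · subst hx2
    obtain rfl : u₁ = z := ((hadj2 u₁).1 h1x.symm).resolve_left h1y.ne
    obtain rfl : u₃ = y := ((hadj2 u₃).1 h3x.symm).resolve_right h13.symm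
    refine ⟨u₃, fun v hv => ?_⟩
    have hall : v ∈ ({u₁, x, u₃} : Set V) := by
      refine h.connected.mem_of_closed (x := u₁) (by simp) ?_ v
      rintro u (rfl | rfl | rfl) w hw
      · rcases (hadj1 w).1 hw with rfl | rfl <;> simp
      · rcases (hadj2 w).1 hw with rfl | rfl <;> simp
      · rcases (hadj3 w).1 hw with rfl | rfl <;> simp
    rcases hall with rfl | rfl | rfl
    · exact ⟨h3z, hu₁⟩
    · exact ⟨h3x, hu₂⟩
    · exact absurd rfl hv
  exfalso
  have e1 := h.eq_of_neighborFinset hyx hN1 h1x.ne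
  have e2 := h.eq_of_neighborFinset hyz hN2 (Ne.symm hx2)
  have e3 := h.eq_of_neighborFinset hxz hN3 h3x.ne
  rw [← h.row_eq_row hu₁ hu₂ x, e1] at e2
  rw [← h.row_eq_row hu₁ hu₃ x, e1] at e3
  have hzx : ¬ G.Adj z x := by
    intro hzx
    simp [hzx] at e2
  have hyx' : ¬ G.Adj y x := by
    intro hyx'
    simp [hzx, hyx'] at e3
  have hM1x : M u₁ x = 0 := by rw [e1]; simp [hyx']
  have hM1y : M u₁ y = 0 := by
    rw [h.eq_of_neighborFinset hyx hN1 h1y.ne]; simp [G.adj_comm x y, hyx']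
  have hdeg (w : V) : G.degree w ≤ 3 := by
    by_cases hw : G.degree w = 2
    · omega
    · refine (h.degree_le hw).trans ((Finset.card_le_card (t := {u₁, u₂, u₃}) ?_).trans
        Finset.card_le_three)
      intro u hu
      simpa using hD u (by simpa using hu)
  have hdx : G.degree x = 3 := by
    have : G.degree x ≠ 2 := by
      intro e
      rcases hD x e with e | e | e
      · exact h1x.ne e.symm
      · exact hx2 e
      · exact h3x.ne e.symm
    have := hdeg x
    have := h.two_le_degree x
    omega
  have hdy : G.degree y = 3 := by
    have : G.degree y ≠ 2 := by
      intro e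
      rcases hD y e with e | e | e
      · exact h1y.ne e.symm
      · exact h2y.ne e.symm
      · exact hyx' (e ▸ h3x)
    have := hdeg y
    have := h.two_le_degree y
    omega
  have hdet := h.det_eq_zero u₁ x y
  rw [hM1x, hM1y, h.diag_of_degree hu₁, h.diag x, h.diag y, hdx, hdy,
    h.off_diag x y hyx.symm] at hdet
  have hcard : 1 < #(G.neighborFinset x ∩ G.neighborFinset y) := by
    by_contra! hle
    have hle' : (#(G.neighborFinset x ∩ G.neighborFinset y) : ℝ) ≤ 1 := by exact_mod_cast hle
    have h0 : (0 : ℝ) ≤ #(G.neighborFinset x ∩ G.neighborFinset y) := Nat.cast_nonneg _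
    norm_num at hdet
    nlinarith
  obtain ⟨w, hw, hw1⟩ := Finset.exists_mem_ne hcard u₁
  simp only [Finset.mem_inter, SimpleGraph.mem_neighborFinset] at hw
  have hge := h.two_le hw1 hyx hw.2.symm h1y hw.1.symm h1x
  have hle := h.sq_le w u₁
  have hw3 : (G.degree w : ℝ) ≤ 3 := by exact_mod_cast hdeg w
  rw [h.diag_of_degree hu₁, h.diag w] at hle
  nlinarith

end IsFriendshipSquare

lemma Cospectral.isFriendshipSquare {V : Type*} [Fintype V] [DecidableEq V] {n : ℕ}
    {G : SimpleGraph V} [DecidableRel G.Adj] (hn : 0 < n)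
    (hG : Cospectral G (friendshipGraph n)) (hconn : G.Connected) :
    ∃ M : Matrix V V ℝ, IsFriendshipSquare G n M := by
  obtain ⟨M, hM, hgram, hMM, htr, hcard⟩ := hG.exists_rank_two
  have hA : adjMat ℝ G = G.adjMatrix ℝ := by
    ext u v
    rw [adjMat_apply, SimpleGraph.adjMatrix_apply]
  rw [hA] at hM hMM
  refine ⟨M, hn, hconn, hcard, fun u v huv => ?_, fun u => ?_, hgram, fun u => ?_, htr⟩
  · rw [hM, Matrix.sub_apply, Matrix.one_apply_ne huv, sub_zero, SimpleGraph.adjMatrix_mul_apply]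
    simp only [SimpleGraph.adjMatrix_apply, Finset.sum_boole]
    congr 2
    ext w
    simp [G.adj_comm v w]
  · rw [hM, Matrix.sub_apply, Matrix.one_apply_eq, SimpleGraph.adjMatrix_mul_self_apply_self]
  · have hsymm (w : V) : M w u = M u w := by
      obtain ⟨a, b, hab⟩ := hgram
      rw [hab, hab]; ring
    have := congr_fun₂ hMM u u
    rw [Matrix.add_apply, Matrix.smul_apply, SimpleGraph.mul_adjMatrix_apply, Matrix.mul_apply]
      at this
    simpa only [hsymm, ← sq, smul_eq_mul] using this

lemma Equiv.Perm.isConj_of_involutive_of_unique_fixed {α : Type*} [Fintype α] [DecidableEq α]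
    {σ τ : Equiv.Perm α} {c d : α} (hσ : Function.Involutive σ) (hτ : Function.Involutive τ)
    (hc : ∀ v, σ v = v ↔ v = c) (hd : ∀ v, τ v = v ↔ v = d) : IsConj σ τ := by
  have key (ρ : Equiv.Perm α) (e : α) (hρ : Function.Involutive ρ) (he : ∀ v, ρ v = v ↔ v = e) :
      ∃ m, ρ.cycleType = Multiset.replicate m 2 ∧ m * 2 = Fintype.card α - 1 := by
    have h2 : ρ ^ 2 = 1 := by
      ext v
      simpa [sq] using hρ v
    have hrep : ρ.cycleType = Multiset.replicate (Multiset.card ρ.cycleType) 2 := by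
      refine Multiset.eq_replicate_card.2 fun k hk => ?_
      have h1 := (Equiv.Perm.dvd_of_mem_cycleType hk).trans (orderOf_dvd_of_pow_eq_one h2)
      have := Nat.le_of_dvd two_pos h1
      have := Equiv.Perm.two_le_of_mem_cycleType hk
      omega
    refine ⟨_, hrep, ?_⟩
    have hs : ρ.support = Finset.univ.erase e := by
      ext v
      simp [he]
    have hsum := ρ.sum_cycleType
    rw [hs, Finset.card_erase_of_mem (Finset.mem_univ e), Finset.card_univ, hrep,
      Multiset.sum_replicate, smul_eq_mul] at hsum
    exact hsum
  obtain ⟨m, hm, hm'⟩ := key σ c hσ hc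
  obtain ⟨k, hk, hk'⟩ := key τ d hτ hd
  rw [Equiv.Perm.isConj_iff_cycleType_eq, hm, hk]
  congr 1
  omega

/-- A graph is determined up to isomorphism by a vertex adjacent to all others, all of which have
degree two, together with the number of vertices. -/
lemma SimpleGraph.iso_friendshipGraph {V : Type*} [Fintype V] [DecidableEq V] {G : SimpleGraph V}
    [DecidableRel G.Adj] {n : ℕ} (hcard : Fintype.card V = 2 * n + 1) {c : V}
    (hc : ∀ v, v ≠ c → G.Adj c v ∧ G.degree v = 2) : Nonempty (G ≃g friendshipGraph n) := by
  have hex (v : V) : ∃ w, if v = c then w = c else w ≠ c ∧ ∀ x, G.Adj v x ↔ x = c ∨ x = w := by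
    by_cases hv : v = c
    · exact ⟨c, by simp [hv]⟩
    · obtain ⟨w, hw, hN⟩ := G.exists_neighborFinset_eq_pair (hc v hv).2 (hc v hv).1.symm
      refine ⟨w, ?_⟩
      rw [if_neg hv]
      refine ⟨hw.symm, fun x => ?_⟩
      rw [← G.mem_neighborFinset, hN]
      simp
  choose f hf using hex
  have hfc : f c = c := by simpa using hf c
  have hfne (v : V) (hv : v ≠ c) : f v ≠ c := by
    have := hf v
    rw [if_neg hv] at this
    exact this.1
  have hadj (v : V) (hv : v ≠ c) (x : V) : G.Adj v x ↔ x = c ∨ x = f v := by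
    have := hf v
    rw [if_neg hv] at this
    exact this.2 x
  have hinv : Function.Involutive f := by
    intro v
    by_cases hv : v = c
    · rw [hv, hfc, hfc]
    · have h1 : G.Adj (f v) v := ((hadj v hv _).2 (Or.inr rfl)).symm
      exact (((hadj _ (hfne v hv) v).1 h1).resolve_left hv).symm
  have hfix (v : V) : f v = v ↔ v = c := by
    refine ⟨fun e => ?_, fun e => by rw [e, hfc]⟩
    by_contra hv
    exact ((hadj v hv (f v)).2 (Or.inr rfl)).ne e.symm
  let τ : Option (Fin n × Bool) → Option (Fin n × Bool) := Option.map (Prod.map id (!·))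
  have hτ : Function.Involutive τ := by
    rintro (_ | ⟨i, a⟩) <;> simp [τ]
  have hτfix (v) : τ v = v ↔ v = none := by
    rcases v with _ | ⟨i, a⟩ <;> simp [τ]
  let e : Option (Fin n × Bool) ≃ V := Fintype.equivOfCardEq (by simp [hcard, mul_comm])
  have hconj : IsConj (hinv.toPerm f) (e.permCongr (hτ.toPerm τ)) := by
    refine Equiv.Perm.isConj_of_involutive_of_unique_fixed (c := c) (d := e none) hinv ?_ hfix ?_
    · intro v
      simp [Equiv.permCongr_apply, hτ _]
    · intro v
      rw [Equiv.permCongr_apply, Function.Involutive.coe_toPerm, ← Equiv.eq_symm_apply, hτfix,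
        Equiv.symm_apply_eq]
  obtain ⟨π, hπ⟩ := isConj_iff.1 hconj
  have hcomm (v : V) : e.symm (π (f v)) = τ (e.symm (π v)) := by
    have := congr_arg (fun ρ : Equiv.Perm V => e.symm (ρ (π v))) hπ
    simpa [Equiv.permCongr_apply] using this
  let φ : V ≃ Option (Fin n × Bool) := π.trans e.symm
  have hφ (v : V) : φ (f v) = τ (φ v) := hcomm v
  have hφc : φ c = none := by
    rw [← hτfix, ← hφ, hfc]
  have hφne (v : V) : φ v = none ↔ v = c := by
    rw [← hφc, φ.apply_eq_iff_eq]
  refine ⟨⟨φ, fun {u v} => ?_⟩⟩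
  by_cases hu : u = c
  · subst hu
    by_cases hv : v = u
    · subst hv
      simp
    · rw [hφc]
      obtain ⟨x, hx⟩ := Option.ne_none_iff_exists'.1 (mt (hφne v).1 hv)
      rw [hx]
      exact iff_of_true (friendshipGraph_adj_none_some x) (hc v hv).1
  · rw [hadj u hu]
    obtain ⟨⟨i, a⟩, hx⟩ := Option.ne_none_iff_exists'.1 (mt (hφne u).1 hu)
    by_cases hv : v = c
    · rw [hv, hφc, hx]
      exact iff_of_true (friendshipGraph_adj_none_some _).symm (Or.inl rfl)
    · obtain ⟨⟨j, b⟩, hy⟩ := Option.ne_none_iff_exists'.1 (mt (hφne v).1 hv)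
      rw [or_iff_right hv, ← φ.apply_eq_iff_eq, hφ, hx, hy]
      rw [friendshipGraph_adj_some_some]
      cases a <;> cases b <;> simp [τ, eq_comm]

/-- if `G` is connected, cospectral with the friendship graph `F n`, and
contains no cycle of length 5 as a (not necessarily induced) subgraph, then `G ≅ F n`. -/
theorem connected_cospectral_C5_free_iso
    {V : Type*} [Fintype V] [DecidableEq V]
    (n : ℕ) (hn : 0 < n) (G : SimpleGraph V)
    (hG : Cospectral G (friendshipGraph n)) (hconn : G.Connected)
    (hC5 : ¬ ∃ a b c d e : V, a ≠ b ∧ a ≠ c ∧ a ≠ d ∧ a ≠ e ∧ b ≠ c ∧ b ≠ d ∧ b ≠ e ∧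
      c ≠ d ∧ c ≠ e ∧ d ≠ e ∧
      G.Adj a b ∧ G.Adj b c ∧ G.Adj c d ∧ G.Adj d e ∧ G.Adj e a) :
    Nonempty (G ≃g friendshipGraph n) := by

  classical
  obtain ⟨M, hM⟩ := hG.isFriendshipSquare hn hconn
  obtain ⟨c, hc⟩ := hM.exists_center
  exact SimpleGraph.iso_friendshipGraph hM.card hc
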